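/- (Closedness under composition, Roumieu) Let (M_j)_{j≥0} be a regular weight sequence, Ω₁ ⊆ ℝ^m and Ω₂ ⊆ ℝⁿ open sets, F : Ω₁ → Ω₂ a map each of whose components is a real-valued function in E_M(Ω₁), and g ∈ E_M(Ω₂). Then the composition g∘F belongs to E_M(Ω₁). -/

import Mathlib

open scoped Topology
open Filter

/-- `m_j = M_j / j!`. -/
noncomputable def mseq (M : ℕ → ℝ) (j : ℕ) : ℝ := M j / (Nat.factorial j : ℝ)

/-- A weight sequence: positive, normalized `M 0 = 1`, log-convex. -/
structure IsWeightSeq (M : ℕ → ℝ) : Prop where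
  pos : ∀ j, 0 < M j
  one : M 0 = 1
  logConvex : ∀ j : ℕ, 1 ≤ j → (M j) ^ 2 ≤ M (j - 1) * M (j + 1)

/-- Condition (M2): `sup_k (m_{k+1}/m_k)^(1/k) < ∞`. -/
def CondM2 (M : ℕ → ℝ) : Prop :=
  ∃ C : ℝ, ∀ k : ℕ, 1 ≤ k → (mseq M (k + 1) / mseq M k) ^ ((1 : ℝ) / k) ≤ C

/-- Condition (M3): log-convexity of `m_k`. -/
def CondM3 (M : ℕ → ℝ) : Prop :=
  ∀ k : ℕ, 1 ≤ k → (mseq M k) ^ 2 ≤ mseq M (k - 1) * mseq M (k + 1)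

/-- Condition (M4): `m_k^(1/k) → ∞`. -/
def CondM4 (M : ℕ → ℝ) : Prop :=
  Filter.Tendsto (fun k : ℕ => (mseq M k) ^ ((1 : ℝ) / k)) Filter.atTop Filter.atTop

/-- A regular weight sequence. -/
structure IsRegularWeightSeq (M : ℕ → ℝ) extends IsWeightSeq M : Prop where
  m_one : mseq M 1 = 1
  cond2 : CondM2 M
  cond3 : CondM3 M
  cond4 : CondM4 M

/-- The associated weight `h_M(t) = inf_k t^k m_k`. -/
noncomputable def weight_h (M : ℕ → ℝ) (t : ℝ) : ℝ := ⨅ k : ℕ, t ^ k * mseq M k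

/-- The associated weight function `ω_M(t) = sup_j log (t^j / M_j)`. -/
noncomputable def weight_omega (M : ℕ → ℝ) (t : ℝ) : ℝ := ⨆ j : ℕ, Real.log (t ^ j / M j)

/-- Membership in the Denjoy-Carleman class `E_M(Ω)`: smooth on `Ω` and on every
compact `K ⊆ Ω` the iterated derivatives satisfy `‖D^k f‖ ≤ C h^k M_k`. -/
def MemDC (M : ℕ → ℝ) {n : ℕ} {E : Type*} [NormedAddCommGroup E] [NormedSpace ℝ E]
    (Ω : Set (Fin n → ℝ)) (f : (Fin n → ℝ) → E) : Prop :=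
  ContDiffOn ℝ (⊤ : ℕ∞) f Ω ∧
  ∀ K : Set (Fin n → ℝ), K ⊆ Ω → IsCompact K →
    ∃ C > 0, ∃ h > 0, ∀ k : ℕ, ∀ x ∈ K,
      ‖iteratedFDerivWithin ℝ k f Ω x‖ ≤ C * h ^ k * M k

universe u

lemma IsRegularWeightSeq.mseq_pos {M : ℕ → ℝ} (hM : IsRegularWeightSeq M) (k : ℕ) :
    0 < mseq M k :=
  div_pos (hM.pos k) (by positivity)

lemma IsRegularWeightSeq.monotone_mseq_ratio {M : ℕ → ℝ} (hM : IsRegularWeightSeq M) :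
    Monotone fun k => mseq M (k + 1) / mseq M k := by
  refine monotone_nat_of_le_succ fun k => ?_
  have h := hM.cond3 (k + 1) (by omega)
  rw [div_le_div_iff₀ (hM.mseq_pos _) (hM.mseq_pos _)]
  simp only [Nat.add_sub_cancel] at h
  linarith

lemma IsRegularWeightSeq.mseq_mul_le {M : ℕ → ℝ} (hM : IsRegularWeightSeq M) (a b : ℕ) :
    mseq M (a + 1) * mseq M (b + 1) ≤ mseq M (a + b + 1) := by
  induction a with
  | zero => simp [hM.m_one]
  | succ a ih =>
    have hpos := hM.mseq_pos
    have h := hM.monotone_mseq_ratio (show a + 1 ≤ a + b + 1 by omega)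
    calc mseq M (a + 1 + 1) * mseq M (b + 1)
        = mseq M (a + 1 + 1) / mseq M (a + 1) * (mseq M (a + 1) * mseq M (b + 1)) := by
          have := (hpos (a + 1)).ne'
          field_simp
      _ ≤ mseq M (a + b + 1 + 1) / mseq M (a + b + 1) * mseq M (a + b + 1) :=
          mul_le_mul h ih (mul_nonneg (hpos _).le (hpos _).le) (div_pos (hpos _) (hpos _)).le
      _ = mseq M (a + 1 + b + 1) := by
          rw [div_mul_cancel₀ _ (hpos _).ne']
          congr 1
          omega

lemma Nat.factorial_add_mul_factorial_add_le (i j r : ℕ) :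
    (i + j).factorial * (r + i).factorial ≤ i.factorial * (r + i + j).factorial := by
  rw [← Nat.factorial_mul_ascFactorial i j, ← Nat.factorial_mul_ascFactorial (r + i) j]
  have : (i + 1).ascFactorial j ≤ (r + i + 1).ascFactorial j := Nat.ascFactorial_le j (by omega)
  calc i.factorial * (i + 1).ascFactorial j * (r + i).factorial
      = i.factorial * (r + i).factorial * (i + 1).ascFactorial j := by ring
    _ ≤ i.factorial * (r + i).factorial * (r + i + 1).ascFactorial j := by gcongr
    _ = _ := by ring

lemma Nat.choose_mul_factorial_mul_factorial_le (i j r : ℕ) :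
    (i + j).choose i * (r + i).factorial * (j + 1).factorial
      ≤ (j + 1) * (r + i + j).factorial := by
  refine Nat.le_of_mul_le_mul_left ?_ i.factorial_pos
  calc i.factorial * ((i + j).choose i * (r + i).factorial * (j + 1).factorial)
      = (j + 1) * (((i + j).choose i * i.factorial * j.factorial) * (r + i).factorial) := by
        rw [Nat.factorial_succ]
        ring
    _ = (j + 1) * ((i + j).factorial * (r + i).factorial) := by
        rw [Nat.choose_symm_add, Nat.add_choose_mul_factorial_mul_factorial]
    _ ≤ (j + 1) * (i.factorial * (r + i + j).factorial) := by
        gcongr (j + 1) * ?_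
        exact Nat.factorial_add_mul_factorial_add_le i j r
    _ = _ := by ring

lemma IsRegularWeightSeq.choose_mul_le {M : ℕ → ℝ} (hM : IsRegularWeightSeq M) (i j r : ℕ) :
    ((i + j).choose i : ℝ) * M (r + 1 + i) * M (j + 1) ≤ (j + 1) * M (r + 1 + i + j) := by
  have hfac : ∀ k, M k = k.factorial * mseq M k := fun k => by
    rw [mseq, mul_div_cancel₀ _ (by positivity)]
  have h1 : ((i + j).choose i * (r + 1 + i).factorial * (j + 1).factorial : ℝ)
      ≤ (j + 1) * (r + 1 + i + j).factorial := by
    exact_mod_cast Nat.choose_mul_factorial_mul_factorial_le i j (r + 1)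
  have h2 : mseq M (r + 1 + i) * mseq M (j + 1) ≤ mseq M (r + 1 + i + j) := by
    convert hM.mseq_mul_le (r + i) j using 2 <;> ring_nf
  have hpos := hM.mseq_pos
  rw [hfac (r + 1 + i), hfac (j + 1), hfac (r + 1 + i + j)]
  calc _ = ((i + j).choose i * (r + 1 + i).factorial * (j + 1).factorial : ℝ)
          * (mseq M (r + 1 + i) * mseq M (j + 1)) := by ring
    _ ≤ ((j + 1) * (r + 1 + i + j).factorial) * mseq M (r + 1 + i + j) :=
        mul_le_mul h1 h2 (mul_nonneg (hpos _).le (hpos _).le) (by positivity)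
    _ = _ := by ring

/-- Pointwise derivative bounds for a composition, in terms of a regular weight sequence. The shift
`r` accounts for `g` being itself an `r`-th derivative. -/
lemma IsRegularWeightSeq.norm_iteratedFDerivWithin_comp_le {M : ℕ → ℝ}
    (hM : IsRegularWeightSeq M) {E : Type*} {F G : Type u}
    [NormedAddCommGroup E] [NormedSpace ℝ E] [NormedAddCommGroup F] [NormedSpace ℝ F]
    [NormedAddCommGroup G] [NormedSpace ℝ G] {f : E → F} {g : F → G} {s : Set E} {t : Set F}
    (hf : ContDiffOn ℝ (⊤ : ℕ∞) f s) (hg : ContDiffOn ℝ (⊤ : ℕ∞) g t)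
    (hs : UniqueDiffOn ℝ s) (ht : UniqueDiffOn ℝ t) (hst : Set.MapsTo f s t) {x : E} (hx : x ∈ s)
    {A a C h : ℝ} (hA : 0 < A) (ha : 0 < a) (hC : 0 < C) (hh : 0 < h)
    (hfb : ∀ j, ‖iteratedFDerivWithin ℝ j f s x‖ ≤ A * a ^ j * M j) (k r : ℕ)
    (hgb : ∀ j, ‖iteratedFDerivWithin ℝ j g t (f x)‖ ≤ C * h ^ (r + j) * M (r + j)) :
    ‖iteratedFDerivWithin ℝ k (g ∘ f) s x‖
      ≤ C * h ^ r * (2 * a * (1 + h * A)) ^ k * M (r + k) := by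
  induction k using Nat.strong_induction_on generalizing G r with
  | h k IH =>
  rcases k with _ | k
  · simpa using hgb 0
  have htop : ((⊤ : ℕ∞) : WithTop ℕ∞) + 1 ≤ ((⊤ : ℕ∞) : WithTop ℕ∞) := le_rfl
  have hg' : ContDiffOn ℝ (⊤ : ℕ∞) (fderivWithin ℝ g t) t := hg.fderivWithin ht htop
  have hf' : ContDiffOn ℝ (⊤ : ℕ∞) (fderivWithin ℝ f s) s := hf.fderivWithin hs htop
  set B := 2 * a * (1 + h * A) with hB
  have hBpos : 0 < B := by positivity
  have hMpos := hM.pos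
  have hI : ∀ i ≤ k, ‖iteratedFDerivWithin ℝ i (fderivWithin ℝ g t ∘ f) s x‖
      ≤ C * h ^ (r + 1) * B ^ i * M (r + 1 + i) := by
    intro i hi
    refine IH i (by omega) hg' (r + 1) fun j => ?_
    rw [norm_iteratedFDerivWithin_fderivWithin ht (hst hx)]
    convert hgb (j + 1) using 3 <;> ring_nf
  have hJ : ∀ j, ‖iteratedFDerivWithin ℝ j (fderivWithin ℝ f s) s x‖
      ≤ A * a ^ (j + 1) * M (j + 1) := by
    intro j
    rw [norm_iteratedFDerivWithin_fderivWithin hs hx]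
    exact hfb (j + 1)
  have hterm : ∀ i j, i + j = k →
      ((k.choose i : ℝ) * (C * h ^ (r + 1) * B ^ i * M (r + 1 + i)))
        * (A * a ^ (j + 1) * M (j + 1))
      ≤ C * h ^ r * M (r + (k + 1)) * (B ^ i * (2 * a) ^ j * (B - 2 * a)) := by
    rintro i j rfl
    have h2 : ((j : ℝ) + 1) ≤ 2 ^ (j + 1) := by
      exact_mod_cast (Nat.lt_two_pow_self (n := j + 1)).le
    calc _ = C * h ^ (r + 1) * B ^ i * A * a ^ (j + 1)
            * (((i + j).choose i : ℝ) * M (r + 1 + i) * M (j + 1)) := by ring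
      _ ≤ C * h ^ (r + 1) * B ^ i * A * a ^ (j + 1)
            * (2 ^ (j + 1) * M (r + 1 + i + j)) := by
          refine mul_le_mul_of_nonneg_left ((hM.choose_mul_le i j r).trans ?_) (by positivity)
          exact mul_le_mul_of_nonneg_right h2 (hMpos _).le
      _ = _ := by
          rw [show r + (i + j + 1) = r + 1 + i + j by ring, hB]
          ring
  calc ‖iteratedFDerivWithin ℝ (k + 1) (g ∘ f) s x‖
      = ‖iteratedFDerivWithin ℝ k (fderivWithin ℝ (g ∘ f) s) s x‖ :=
        (norm_iteratedFDerivWithin_fderivWithin hs hx).symm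
    _ = ‖iteratedFDerivWithin ℝ k (fun y => ContinuousLinearMap.compL ℝ E F G
          (fderivWithin ℝ g t (f y)) (fderivWithin ℝ f s y)) s x‖ := by
        congr 1
        refine iteratedFDerivWithin_congr (fun y hy => ?_) hx _
        exact fderivWithin_comp _ (hg.differentiableOn (by simp) _ (hst hy))
          (hf.differentiableOn (by simp) _ hy) hst (hs y hy)
    _ ≤ ∑ i ∈ Finset.range (k + 1),
          (k.choose i : ℝ) * ‖iteratedFDerivWithin ℝ i (fderivWithin ℝ g t ∘ f) s x‖ *
            ‖iteratedFDerivWithin ℝ (k - i) (fderivWithin ℝ f s) s x‖ :=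
        (ContinuousLinearMap.compL ℝ E F G).norm_iteratedFDerivWithin_le_of_bilinear_of_le_one
          (hg'.comp hf hst) hf' hs hx (by exact_mod_cast le_top)
          (ContinuousLinearMap.norm_compL_le ℝ E F G)
    _ ≤ ∑ i ∈ Finset.range (k + 1),
          C * h ^ r * M (r + (k + 1)) * (B ^ i * (2 * a) ^ (k - i) * (B - 2 * a)) := by
        refine Finset.sum_le_sum fun i hi => ?_
        have hik : i ≤ k := Finset.mem_range_succ_iff.1 hi
        refine le_trans ?_ (hterm i (k - i) (by omega))
        have := hMpos (r + 1 + i)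
        gcongr
        · exact hI i hik
        · exact hJ (k - i)
    _ = C * h ^ r * M (r + (k + 1)) * (B ^ (k + 1) - (2 * a) ^ (k + 1)) := by
        rw [← Finset.mul_sum, ← Finset.sum_mul, ← geom_sum₂_mul]
        simp
    _ ≤ C * h ^ r * M (r + (k + 1)) * B ^ (k + 1) := by
        have := hMpos (r + (k + 1))
        gcongr
        simp only [sub_le_self_iff]
        positivity
    _ = _ := by ring

/-- A map into `Fin n → ℝ` whose components lie in the Denjoy-Carleman class does so itself. -/
lemma MemDC.pi {M : ℕ → ℝ} (hM : ∀ k, 0 < M k) {m n : ℕ} {Ω : Set (Fin m → ℝ)}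
    (hΩ : IsOpen Ω) {F : (Fin m → ℝ) → (Fin n → ℝ)}
    (hF : ∀ i : Fin n, MemDC M Ω (fun x => F x i)) : MemDC M Ω F := by
  have hsmooth : ContDiffOn ℝ (⊤ : ℕ∞) F Ω := contDiffOn_pi.2 fun i => (hF i).1
  refine ⟨hsmooth, fun K hK hKc => ?_⟩
  choose C hC h hh hb using fun i => (hF i).2 K hK hKc
  have hCsum : 0 ≤ ∑ i, C i := Finset.sum_nonneg fun i _ => (hC i).le
  have hhsum : 0 ≤ ∑ i, h i := Finset.sum_nonneg fun i _ => (hh i).le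
  refine ⟨1 + ∑ i, C i, by positivity, 1 + ∑ i, h i, by positivity, fun k x hx => ?_⟩
  have hMk := hM k
  refine ContinuousMultilinearMap.opNorm_le_bound (by positivity) fun v => ?_
  refine (pi_norm_le_iff_of_nonneg (by positivity)).2 fun i => ?_
  have hcomp : iteratedFDerivWithin ℝ k F Ω x v i
      = iteratedFDerivWithin ℝ k (fun y => F y i) Ω x v := by
    have := ContinuousLinearMap.iteratedFDerivWithin_comp_left
      (ContinuousLinearMap.proj (R := ℝ) (φ := fun _ : Fin n => ℝ) i) (hsmooth x (hK hx))
      hΩ.uniqueDiffOn (hK hx)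
      (i := k) (by exact_mod_cast le_top)
    exact (congrArg (fun L => L v) this).symm
  have hCi : C i ≤ 1 + ∑ i, C i := by
    linarith [Finset.single_le_sum (fun i _ => (hC i).le) (Finset.mem_univ i)]
  have hhi : h i ≤ 1 + ∑ i, h i := by
    linarith [Finset.single_le_sum (fun i _ => (hh i).le) (Finset.mem_univ i)]
  have hi0 := (hh i).le
  rw [hcomp]
  refine (ContinuousMultilinearMap.le_opNorm _ v).trans ?_
  gcongr
  refine (hb i k x hx).trans ?_
  gcongr

/-- Closedness under composition (Roumieu): if `F : Ω₁ → Ω₂` has components in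
`E_M(Ω₁)` and `g ∈ E_M(Ω₂)`, then `g ∘ F ∈ E_M(Ω₁)`. -/
theorem stmt_15 (M : ℕ → ℝ) (hM : IsRegularWeightSeq M)
    {m n : ℕ} (Ω₁ : Set (Fin m → ℝ)) (Ω₂ : Set (Fin n → ℝ))
    (h1 : IsOpen Ω₁) (h2 : IsOpen Ω₂)
    (F : (Fin m → ℝ) → (Fin n → ℝ)) (hmaps : Set.MapsTo F Ω₁ Ω₂)
    (hF : ∀ i : Fin n, MemDC M Ω₁ (fun x => F x i))
    (g : (Fin n → ℝ) → ℂ) (hg : MemDC M Ω₂ g) :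
    MemDC M Ω₁ (g ∘ F) := by
  have hFm : MemDC M Ω₁ F := MemDC.pi hM.pos h1 hF
  refine ⟨hg.1.comp hFm.1 hmaps, fun K hK hKc => ?_⟩
  obtain ⟨A, hA, a, ha, hfb⟩ := hFm.2 K hK hKc
  obtain ⟨C, hC, h, hh, hgb⟩ := hg.2 (F '' K) ((hmaps.mono_left hK).image_subset)
    (hKc.image_of_continuousOn (hFm.1.continuousOn.mono hK))
  refine ⟨C, hC, 2 * a * (1 + h * A), by positivity, fun k x hx => ?_⟩
  simpa using hM.norm_iteratedFDerivWithin_comp_le hFm.1 hg.1 h1.uniqueDiffOn h2.uniqueDiffOn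
    hmaps (hK hx) hA ha hC hh (fun j => hfb j x hx) k 0
    (fun j => by simpa using hgb j (F x) (Set.mem_image_of_mem F hx))
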